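/- arXiv:1003.6025 — 2 statements merged into one kernel-verified Lean document; each statement's English description precedes it below -/
import Mathlib

section
/- Let n ≥ 2 and let 0 ≤ r < 1 < R. If f is holomorphic on the spherical shell {z ∈ ℂⁿ : r < ‖z‖ < R}, then there exists a function F holomorphic on the ball {z ∈ ℂⁿ : ‖z‖ < R} such that F = f on the shell {z ∈ ℂⁿ : r < ‖z‖ < R}. In particular, every function holomorphic in a neighborhood of the Euclidean unit sphere in ℂⁿ extends holomorphically to the full Euclidean ball. -/
open Set Metric Filter Topology

/-- A parametric integral of a function that is jointly continuous and holomorphic in the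
parameter is holomorphic in the parameter. -/
theorem differentiableOn_intervalIntegral_of_holomorphic {E : Type*} [NormedAddCommGroup E]
    [NormedSpace ℂ E] [FiniteDimensional ℂ E] {U : Set E} (hU : IsOpen U) {K : E → ℝ → ℂ}
    (hc : ContinuousOn (fun p : E × ℝ => K p.1 p.2) (U ×ˢ univ))
    (hd : ∀ θ, DifferentiableOn ℂ (fun z => K z θ) U) (a b : ℝ) :
    DifferentiableOn ℂ (fun z => ∫ θ in a..b, K z θ) U := by
  have : ProperSpace E := FiniteDimensional.proper ℂ E
  intro p hp
  obtain ⟨ε, hε, hεU⟩ := Metric.isOpen_iff.1 hU p hp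
  obtain ⟨δ, hδ, hδε⟩ : ∃ δ, 0 < δ ∧ 2 * δ < ε := ⟨ε / 3, by positivity, by linarith⟩
  have hsub : closedBall p (2 * δ) ⊆ U := (closedBall_subset_ball hδε).trans hεU
  have hcomp : IsCompact (closedBall p (2 * δ) ×ˢ uIcc a b) :=
    (isCompact_closedBall _ _).prod isCompact_uIcc
  have hcK : ContinuousOn (fun p : E × ℝ => K p.1 p.2) (closedBall p (2 * δ) ×ˢ uIcc a b) :=
    hc.mono (prod_mono hsub (subset_univ _))
  have hcz : ∀ z ∈ U, Continuous (K z) := fun z hz =>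
    continuousOn_univ.1 <| hc.comp (f := fun θ : ℝ => (z, θ)) (by fun_prop)
      fun θ _ => ⟨hz, mem_univ _⟩
  obtain ⟨M, hM⟩ := hcomp.exists_bound_of_continuousOn hcK
  have hball : ∀ x ∈ ball p δ, ball x δ ⊆ closedBall p (2 * δ) := fun x hx y hy => by
    rw [mem_ball] at hx hy
    rw [mem_closedBall]
    linarith [dist_triangle y x p]
  have hcauchy : ∀ (g : E → ℂ) (C : ℝ), DifferentiableOn ℂ g U →
      (∀ y ∈ closedBall p (2 * δ), ‖g y‖ ≤ C) → ∀ x ∈ ball p δ, ‖fderiv ℂ g x‖ ≤ 2 * C / δ := by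
    intro g C hg hC x hx
    refine Complex.norm_fderiv_le_div_of_mapsTo_ball
      (hg.mono ((hball x hx).trans hsub)) (fun y hy => ?_) hδ
    rw [mem_closedBall, dist_eq_norm]
    have h1 := hC y (hball x hx hy)
    have h2 := hC x (hball x hx (mem_ball_self hδ))
    linarith [norm_sub_le (g y) (g x)]
  have hpU : ∀ θ, DifferentiableAt ℂ (fun z => K z θ) p := fun θ =>
    (hd θ).differentiableAt (hU.mem_nhds hp)
  have hcd : ContinuousOn (fun θ => fderiv ℂ (fun z => K z θ) p) (uIcc a b) := by
    have huc := hcomp.uniformContinuousOn_of_continuous hcK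
    rw [Metric.uniformContinuousOn_iff] at huc
    rw [Metric.continuousOn_iff]
    intro θ₀ hθ₀ η hη
    obtain ⟨κ, hκ, hκ'⟩ := huc (η * δ / 4) (by positivity)
    refine ⟨κ, hκ, fun θ hθ hdist => ?_⟩
    have h := hcauchy (fun z => K z θ - K z θ₀) (η * δ / 4) ((hd θ).sub (hd θ₀))
      (fun y hy => by
        have := hκ' (y, θ) ⟨hy, hθ⟩ (y, θ₀) ⟨hy, hθ₀⟩ (by simpa [Prod.dist_eq, hκ] using hdist)
        rw [dist_eq_norm] at this
        exact this.le) p (mem_ball_self hδ)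
    rw [fderiv_fun_sub (hpU θ) (hpU θ₀)] at h
    rw [dist_eq_norm]
    calc _ ≤ _ := h
      _ = η / 2 := by field_simp; norm_num
      _ < η := by linarith
  refine (intervalIntegral.hasFDerivAt_integral_of_dominated_of_fderiv_le (𝕜 := ℂ)
    (F' := fun x θ => fderiv ℂ (fun z => K z θ) x) (bound := fun _ => 2 * M / δ)
    (ball_mem_nhds p hδ) ?_ ((hcz p hp).intervalIntegrable _ _) ?_ ?_ (by simp) ?_
    ).differentiableAt.differentiableWithinAt
  · filter_upwards [hU.mem_nhds hp] with z hz using (hcz z hz).aestronglyMeasurable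
  · exact (hcd.mono uIoc_subset_uIcc).aestronglyMeasurable measurableSet_uIoc
  · exact Eventually.of_forall fun θ hθ x hx => hcauchy _ _ (hd θ)
      (fun y hy => hM (y, θ) ⟨hy, uIoc_subset_uIcc hθ⟩) x hx
  · exact Eventually.of_forall fun θ _ x hx => ((hd θ).differentiableAt
      (hU.mem_nhds (hsub (hball x hx (mem_ball_self hδ))))).hasFDerivAt

/-- The identity theorem for holomorphic functions on a preconnected open set of a complex
normed space. -/
theorem eqOn_of_isPreconnected_of_eventuallyEq_of_differentiableOn {E : Type*}
    [NormedAddCommGroup E] [NormedSpace ℂ E] {U : Set E} (hU : IsOpen U) (hc : IsPreconnected U)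
    {f g : E → ℂ} (hf : DifferentiableOn ℂ f U) (hg : DifferentiableOn ℂ g U)
    {x : E} (hx : x ∈ U) (hfg : f =ᶠ[𝓝 x] g) : EqOn f g U := by
  suffices h : U ⊆ {z | f =ᶠ[𝓝 z] g} from fun z hz => (h hz).eq_of_nhds
  refine hc.subset_of_closure_inter_subset isOpen_setOfPred_eventually_nhds ⟨x, hx, hfg⟩ ?_
  rintro p ⟨hpc, hpU⟩
  obtain ⟨ε, hε, hεU⟩ := Metric.isOpen_iff.1 hU p hpU
  obtain ⟨q, hq, hqp⟩ := mem_closure_iff_nhds.1 hpc _ (ball_mem_nhds p hε)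
  refine eventually_of_mem (ball_mem_nhds p hε) fun z hz => ?_
  set L : ℂ → E := fun t => q + t • (z - q) with hL
  have hLd : Differentiable ℂ L := by fun_prop
  set V : Set ℂ := L ⁻¹' ball p ε with hV
  have hVo : IsOpen V := isOpen_ball.preimage hLd.continuous
  have hVc : IsPreconnected V := by
    refine Convex.isPreconnected ?_
    intro s hs t ht α β hα hβ hαβ
    have h := convex_ball p ε hs ht hα hβ hαβ
    have hα' : (α : ℂ) = 1 - β := by
      rw [← Complex.ofReal_one, ← hαβ]
      push_cast
      ring
    have : L (α • s + β • t) = α • L s + β • L t := by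
      simp only [hL, ← Complex.coe_smul, hα', smul_eq_mul]
      module
    rw [← this] at h
    exact h
  have hmaps : MapsTo L V U := fun t ht => hεU ht
  have h0 : (0 : ℂ) ∈ V := by simpa [hV, hL] using hq
  have h1 : (1 : ℂ) ∈ V := by simpa [hV, hL] using hz
  have key : EqOn (f ∘ L) (g ∘ L) V := by
    refine ((hf.comp hLd.differentiableOn hmaps).analyticOnNhd hVo
      ).eqOn_of_preconnected_of_eventuallyEq
      ((hg.comp hLd.differentiableOn hmaps).analyticOnNhd hVo) hVc h0 ?_
    have : Tendsto L (𝓝 0) (𝓝 q) := by simpa [hL] using hLd.continuous.tendsto 0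
    exact this.eventually hqp
  simpa [hL] using key h1

theorem isPreconnected_shell {E : Type*} [NormedAddCommGroup E] [NormedSpace ℝ E]
    (h : 1 < Module.rank ℝ E) {r R : ℝ} (hr : 0 ≤ r) :
    IsPreconnected {z : E | r < ‖z‖ ∧ ‖z‖ < R} := by
  have hp := ((isPreconnected_sphere h (0 : E) 1).prod (isPreconnected_Ioo (a := r) (b := R))
    ).image (fun p : E × ℝ => p.2 • p.1) (by fun_prop)
  convert hp using 1
  ext z
  simp only [mem_ofPred_eq, mem_image, mem_prod, mem_sphere_zero_iff_norm, mem_Ioo, Prod.exists]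
  constructor
  · rintro ⟨h1, h2⟩
    have hz : ‖z‖ ≠ 0 := (hr.trans_lt h1).ne'
    exact ⟨‖z‖⁻¹ • z, ‖z‖, ⟨by simp [norm_smul, hz], h1, h2⟩, by simp [smul_smul, hz]⟩
  · rintro ⟨v, t, ⟨hv, h1, h2⟩, rfl⟩
    rw [norm_smul, hv, mul_one, Real.norm_of_nonneg (hr.trans h1.le)]
    exact ⟨h1, h2⟩

theorem isOpen_shell {E : Type*} [SeminormedAddCommGroup E] (r R : ℝ) :
    IsOpen {z : E | r < ‖z‖ ∧ ‖z‖ < R} :=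
  (isOpen_lt continuous_const continuous_norm).inter (isOpen_lt continuous_norm continuous_const)

section CauchySlice

variable {E : Type*} [NormedAddCommGroup E] [InnerProductSpace ℂ E]

/-- The point obtained from `z` by replacing its coordinate along the unit vector `e` by `ζ`. -/
noncomputable def sliceMap (e z : E) (ζ : ℂ) : E := z + (ζ - inner ℂ e z) • e

/-- The squared norm of the component of `z` orthogonal to the unit vector `e`. -/
noncomputable def orthNormSq (e z : E) : ℝ := ‖z‖ ^ 2 - ‖inner ℂ e z‖ ^ 2

/-- The Cauchy integral of `f` over the circle of radius `ρ` in the direction `e`. -/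
noncomputable def sliceCauchy (e : E) (f : E → ℂ) (ρ : ℝ) (z : E) : ℂ :=
  (2 * Real.pi * Complex.I : ℂ)⁻¹ •
    ∮ ζ in C(0, ρ), (ζ - inner ℂ e z)⁻¹ • f (sliceMap e z ζ)

theorem sliceMap_inner_self (e z : E) : sliceMap e z (inner ℂ e z) = z := by
  simp [sliceMap]

theorem norm_sliceMap_sq {e : E} (he : ‖e‖ = 1) (z : E) (ζ : ℂ) :
    ‖sliceMap e z ζ‖ ^ 2 = ‖ζ‖ ^ 2 + orthNormSq e z := by
  have hee : inner ℂ e e = (1 : ℂ) := by simp [inner_self_eq_norm_sq_to_K, he]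
  set w : E := z - (inner ℂ e z : ℂ) • e with hw
  have hwe : inner ℂ e w = (0 : ℂ) := by
    rw [hw, inner_sub_right, inner_smul_right, hee, mul_one, sub_self]
  have key : ∀ η : ℂ, ‖w + η • e‖ ^ 2 = ‖w‖ ^ 2 + ‖η‖ ^ 2 := fun η => by
    have : inner ℂ w (η • e) = (0 : ℂ) := by
      rw [inner_smul_right, inner_eq_zero_symm.1 hwe, mul_zero]
    have := norm_add_sq_eq_norm_sq_add_norm_sq_of_inner_eq_zero w (η • e) this
    rw [norm_smul, he, mul_one] at this
    linarith [this, sq ‖w + η • e‖, sq ‖w‖, sq ‖η‖]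
  have h1 : sliceMap e z ζ = w + ζ • e := by rw [sliceMap, hw, sub_smul]; abel
  have h2 : z = w + (inner ℂ e z : ℂ) • e := by rw [hw]; abel
  have h3 := key (inner ℂ e z)
  rw [← h2] at h3
  rw [h1, key, orthNormSq, h3]
  ring

theorem continuous_orthNormSq (e : E) : Continuous (orthNormSq e) := by
  unfold orthNormSq
  fun_prop

theorem differentiable_sliceMap (e z : E) : Differentiable ℂ (sliceMap e z) := by
  unfold sliceMap
  fun_prop

variable {e : E} {r R : ℝ} {f : E → ℂ}

theorem sliceMap_mem_shell (he : ‖e‖ = 1) (hR : 0 ≤ R) {z : E} {ζ : ℂ}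
    (h1 : r ^ 2 < ‖ζ‖ ^ 2 + orthNormSq e z) (h2 : ‖ζ‖ ^ 2 + orthNormSq e z < R ^ 2) :
    sliceMap e z ζ ∈ {z : E | r < ‖z‖ ∧ ‖z‖ < R} := by
  rw [← norm_sliceMap_sq he] at h1 h2
  exact ⟨lt_of_pow_lt_pow_left₀ 2 (norm_nonneg _) h1, lt_of_pow_lt_pow_left₀ 2 hR h2⟩

theorem sliceCauchy_eq_of_le (he : ‖e‖ = 1) (hR : 0 ≤ R)
    (hf : DifferentiableOn ℂ f {z | r < ‖z‖ ∧ ‖z‖ < R}) {z : E} {ρ₁ ρ₂ : ℝ}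
    (hle : ρ₁ ≤ ρ₂) (hz : ‖inner ℂ e z‖ < ρ₁) (h1 : r ^ 2 < ρ₁ ^ 2 + orthNormSq e z)
    (h2 : ρ₂ ^ 2 + orthNormSq e z < R ^ 2) :
    sliceCauchy e f ρ₂ z = sliceCauchy e f ρ₁ z := by
  have hρ₁ : 0 < ρ₁ := (norm_nonneg _).trans_lt hz
  set g : ℂ → ℂ := fun ζ => ζ * ((ζ - inner ℂ e z)⁻¹ • f (sliceMap e z ζ)) with hg
  have hcirc : ∀ ρ, 0 < ρ → (∮ ζ in C(0, ρ), (ζ - inner ℂ e z)⁻¹ • f (sliceMap e z ζ)) =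
      ∮ ζ in C(0, ρ), (ζ - 0)⁻¹ • g ζ := fun ρ hρ => by
    refine circleIntegral.integral_congr hρ.le fun ζ hζ => ?_
    have : ζ ≠ 0 := ne_of_mem_sphere hζ hρ.ne'
    simp [hg, this]
  have hgd : ∀ ζ : ℂ, ρ₁ ≤ ‖ζ‖ → ‖ζ‖ ≤ ρ₂ → DifferentiableAt ℂ g ζ := fun ζ h h' => by
    have hmem : sliceMap e z ζ ∈ {z : E | r < ‖z‖ ∧ ‖z‖ < R} := by
      refine sliceMap_mem_shell he hR (h1.trans_le ?_) (lt_of_le_of_lt ?_ h2) <;> gcongr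
    have hne : ζ - inner ℂ e z ≠ 0 := sub_ne_zero.2 fun h0 => by
      rw [h0] at h
      exact (hz.trans_le h).false
    have hfs : DifferentiableAt ℂ (fun ζ => f (sliceMap e z ζ)) ζ :=
      (hf.differentiableAt ((isOpen_shell r R).mem_nhds hmem)).comp ζ (differentiable_sliceMap e z ζ)
    exact differentiableAt_id.fun_mul
      ((DifferentiableAt.fun_inv (z := ζ) (h := fun ζ => ζ - inner ℂ e z) (by fun_prop)
        hne).fun_smul hfs)
  unfold sliceCauchy
  rw [hcirc _ hρ₁, hcirc _ (hρ₁.trans_le hle)]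
  congr 1
  refine Complex.circleIntegral_sub_center_inv_smul_eq_of_differentiable_on_annulus_off_countable
    hρ₁ hle countable_empty (fun ζ hζ => ?_) (fun ζ hζ => ?_)
  · refine (hgd ζ ?_ ?_).continuousAt.continuousWithinAt
    · simpa using hζ.2
    · simpa using hζ.1
  · refine hgd ζ ?_ ?_
    · simpa using (not_le.1 (by simpa using hζ.1.2) : ρ₁ < ‖ζ‖).le
    · exact (by simpa using hζ.1.1 : ‖ζ‖ < ρ₂).le

theorem sliceCauchy_eq (he : ‖e‖ = 1) (hR : 0 ≤ R)
    (hf : DifferentiableOn ℂ f {z | r < ‖z‖ ∧ ‖z‖ < R}) {z : E} {ρ₁ ρ₂ : ℝ}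
    (hz₁ : ‖inner ℂ e z‖ < ρ₁) (hr₁ : r ^ 2 < ρ₁ ^ 2 + orthNormSq e z)
    (hR₁ : ρ₁ ^ 2 + orthNormSq e z < R ^ 2)
    (hz₂ : ‖inner ℂ e z‖ < ρ₂) (hr₂ : r ^ 2 < ρ₂ ^ 2 + orthNormSq e z)
    (hR₂ : ρ₂ ^ 2 + orthNormSq e z < R ^ 2) :
    sliceCauchy e f ρ₁ z = sliceCauchy e f ρ₂ z := by
  rcases le_total ρ₁ ρ₂ with h | h
  · exact (sliceCauchy_eq_of_le he hR hf h hz₁ hr₁ hR₂).symm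
  · exact sliceCauchy_eq_of_le he hR hf h hz₂ hr₂ hR₁

theorem sliceCauchy_eq_self (he : ‖e‖ = 1) (hR : 0 ≤ R)
    (hf : DifferentiableOn ℂ f {z | r < ‖z‖ ∧ ‖z‖ < R}) {z : E} {ρ : ℝ}
    (hz : ‖inner ℂ e z‖ < ρ) (h1 : r ^ 2 < orthNormSq e z)
    (h2 : ρ ^ 2 + orthNormSq e z < R ^ 2) :
    sliceCauchy e f ρ z = f z := by
  have hd : DifferentiableOn ℂ (fun ζ => f (sliceMap e z ζ)) (closedBall 0 ρ) := by
    refine hf.comp (differentiable_sliceMap e z).differentiableOn fun ζ hζ => ?_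
    have hζ' : ‖ζ‖ ≤ ρ := by simpa using hζ
    refine sliceMap_mem_shell he hR ?_ (lt_of_le_of_lt ?_ h2)
    · linarith [sq_nonneg ‖ζ‖]
    · gcongr
  have := (hd.diffContOnCl_ball subset_rfl).two_pi_i_inv_smul_circleIntegral_sub_inv_smul
    (w := inner ℂ e z) (by simpa using hz)
  rwa [sliceMap_inner_self] at this

theorem differentiableAt_sliceCauchy [FiniteDimensional ℂ E] (he : ‖e‖ = 1)
    (hR : 0 ≤ R) (hf : DifferentiableOn ℂ f {z | r < ‖z‖ ∧ ‖z‖ < R}) {z : E} {ρ : ℝ}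
    (hz : ‖inner ℂ e z‖ < ρ) (h1 : r ^ 2 < ρ ^ 2 + orthNormSq e z)
    (h2 : ρ ^ 2 + orthNormSq e z < R ^ 2) :
    DifferentiableAt ℂ (sliceCauchy e f ρ) z := by
  have hρ : 0 < ρ := (norm_nonneg _).trans_lt hz
  have hs := continuous_orthNormSq e
  set U : Set E := {z | ‖inner ℂ e z‖ < ρ ∧ r ^ 2 < ρ ^ 2 + orthNormSq e z ∧
    ρ ^ 2 + orthNormSq e z < R ^ 2}
  have hin : Continuous fun z : E => ‖inner ℂ e z‖ := by fun_prop
  have hU : IsOpen U := (isOpen_lt hin continuous_const).inter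
    ((isOpen_lt continuous_const (continuous_const.add hs)).inter
      (isOpen_lt (continuous_const.add hs) continuous_const))
  have hnorm : ∀ θ : ℝ, ‖circleMap 0 ρ θ‖ = ρ := fun θ => by simp [abs_of_pos hρ]
  have hne : ∀ x ∈ U, ∀ θ : ℝ, circleMap 0 ρ θ - inner ℂ e x ≠ 0 := fun x hx θ =>
    sub_ne_zero.2 fun h0 => by
      have := hx.1
      rw [← h0, hnorm] at this
      exact this.false
  have hmem : ∀ x ∈ U, ∀ θ : ℝ, sliceMap e x (circleMap 0 ρ θ) ∈ {z : E | r < ‖z‖ ∧ ‖z‖ < R} :=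
    fun x hx θ => sliceMap_mem_shell he hR (by rw [hnorm]; exact hx.2.1)
      (by rw [hnorm]; exact hx.2.2)
  have hinner : Differentiable ℂ (fun x : E => (inner ℂ e x : ℂ)) := (innerSL ℂ e).differentiable
  have hdiff : DifferentiableOn ℂ (fun x => ∫ θ in (0 : ℝ)..2 * Real.pi,
      deriv (circleMap 0 ρ) θ • ((circleMap 0 ρ θ - inner ℂ e x)⁻¹ •
        f (sliceMap e x (circleMap 0 ρ θ)))) U := by
    refine differentiableOn_intervalIntegral_of_holomorphic hU ?_ (fun θ => ?_) _ _
    · have hcm : Continuous fun p : E × ℝ => circleMap 0 ρ p.2 :=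
        (continuous_circleMap 0 ρ).comp continuous_snd
      simp only [deriv_circleMap]
      have hinv : ContinuousOn (fun p : E × ℝ => (circleMap 0 ρ p.2 - inner ℂ e p.1)⁻¹)
          (U ×ˢ univ) := ContinuousOn.inv₀ (by fun_prop) fun p hp => hne p.1 hp.1 p.2
      refine ContinuousOn.smul
        (f := fun p : E × ℝ => circleMap 0 ρ p.2 * Complex.I) (by fun_prop) (hinv.smul ?_)
      refine hf.continuousOn.comp (f := fun p : E × ℝ => sliceMap e p.1 (circleMap 0 ρ p.2)) ?_
        fun p hp => hmem p.1 hp.1 p.2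
      unfold sliceMap
      fun_prop
    · refine DifferentiableOn.fun_const_smul (DifferentiableOn.fun_smul
        (DifferentiableOn.fun_inv (by fun_prop) fun x hx => hne x hx θ) ?_) _
      refine hf.comp (f := fun x : E => sliceMap e x (circleMap 0 ρ θ)) ?_ fun x hx => hmem x hx θ
      unfold sliceMap
      fun_prop
  exact (hdiff.differentiableAt (hU.mem_nhds ⟨hz, h1, h2⟩)).fun_const_smul _

/-- Hartogs extension from a spherical shell in a finite-dimensional complex inner product space
containing two orthonormal vectors. -/
theorem exists_differentiableOn_ball_eq_on_shell [FiniteDimensional ℂ E] {e' : E} (he : ‖e‖ = 1)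
    (he' : ‖e'‖ = 1) (hee' : inner ℂ e e' = (0 : ℂ)) (hr : 0 ≤ r) (hrR : r < R)
    (hf : DifferentiableOn ℂ f {z | r < ‖z‖ ∧ ‖z‖ < R}) :
    ∃ F : E → ℂ, DifferentiableOn ℂ F {z | ‖z‖ < R} ∧ ∀ z, r < ‖z‖ → ‖z‖ < R → F z = f z := by
  have hR : 0 ≤ R := hr.trans hrR.le
  have hrR2 : r ^ 2 < R ^ 2 := by gcongr
  have hs := continuous_orthNormSq e
  have hin : Continuous fun z : E => ‖inner ℂ e z‖ := by fun_prop
  have hρ : ∀ z : E, ∃ ρ : ℝ, ‖z‖ < R → ‖inner ℂ e z‖ < ρ ∧ r ^ 2 < ρ ^ 2 + orthNormSq e z ∧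
      ρ ^ 2 + orthNormSq e z < R ^ 2 := by
    intro z
    by_cases hz : ‖z‖ < R
    · obtain ⟨t, ht, htR⟩ := exists_between
        (max_lt hrR2 (show ‖z‖ ^ 2 < R ^ 2 by gcongr))
      obtain ⟨htr, htz⟩ := max_lt_iff.1 ht
      have hpos : ‖inner ℂ e z‖ ^ 2 < t - orthNormSq e z := by
        rw [orthNormSq]
        linarith
      refine ⟨√(t - orthNormSq e z), fun _ => ⟨Real.lt_sqrt_of_sq_lt hpos, ?_⟩⟩
      rw [Real.sq_sqrt ((sq_nonneg _).trans hpos.le)]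
      constructor <;> linarith
    · exact ⟨0, fun h => absurd h hz⟩
  choose ρ hρ using hρ
  have hF : DifferentiableOn ℂ (fun z => sliceCauchy e f (ρ z) z) {z | ‖z‖ < R} := by
    intro z hz
    obtain ⟨h0, h1, h2⟩ := hρ z hz
    refine ((differentiableAt_sliceCauchy he hR hf h0 h1 h2).congr_of_eventuallyEq ?_
      ).differentiableWithinAt
    filter_upwards [(isOpen_lt continuous_norm continuous_const).mem_nhds hz,
      (isOpen_lt hin (continuous_const (y := ρ z))).mem_nhds h0,
      (isOpen_lt continuous_const (continuous_const.add hs)).mem_nhds h1,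
      (isOpen_lt (continuous_const.add hs) continuous_const).mem_nhds h2] with w hw hw0 hw1 hw2
    obtain ⟨k0, k1, k2⟩ := hρ w hw
    exact sliceCauchy_eq he hR hf k0 k1 k2 hw0 hw1 hw2
  refine ⟨_, hF, fun z hz hzR => ?_⟩
  obtain ⟨c, hrc, hcR⟩ := exists_between hrR
  have hc : ‖(c : ℂ) • e'‖ = c := by
    simp [norm_smul, he', abs_of_nonneg (hr.trans hrc.le)]
  have hrank : 1 < Module.rank ℝ E := by
    have : Nontrivial E := ⟨e, 0, fun h => by simp [h] at he⟩
    rw [← Module.finrank_eq_rank, finrank_real_of_complex]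
    have := Module.finrank_pos (R := ℂ) (M := E)
    exact_mod_cast (by omega : 1 < 2 * Module.finrank ℂ E)
  refine eqOn_of_isPreconnected_of_eventuallyEq_of_differentiableOn (isOpen_shell r R)
    (isPreconnected_shell hrank hr) (hF.mono fun z hz => hz.2) hf
    (x := (c : ℂ) • e') ⟨by rwa [hc], by rwa [hc]⟩ ?_ ⟨hz, hzR⟩
  have hsc : r ^ 2 < orthNormSq e ((c : ℂ) • e') := by
    rw [orthNormSq, hc, inner_smul_right, hee']
    simp only [mul_zero, norm_zero]
    nlinarith
  filter_upwards [(isOpen_lt continuous_norm (continuous_const (y := R))).mem_nhds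
      (show ‖(c : ℂ) • e'‖ < R by rwa [hc]),
    (isOpen_lt continuous_const hs).mem_nhds hsc] with w hw hw1
  obtain ⟨k0, -, k2⟩ := hρ w hw
  exact sliceCauchy_eq_self he hR hf k0 hw1 k2

end CauchySlice

/-- **Hartogs extension from a spherical shell.** If `n ≥ 2`, `0 ≤ r < 1 < R`, and `f` is
holomorphic on the shell `{z : r < ‖z‖ < R}` in `ℂⁿ`, then `f` extends holomorphically to
the ball `{z : ‖z‖ < R}`.  In particular every function holomorphic in a neighborhood of the
unit sphere extends holomorphically to the full ball. -/
theorem hartogs_extension_spherical_shell (n : ℕ) (hn : 2 ≤ n) (r R : ℝ)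
    (hr0 : 0 ≤ r) (hr1 : r < 1) (hR : 1 < R)
    (f : EuclideanSpace ℂ (Fin n) → ℂ)
    (hf : DifferentiableOn ℂ f {z : EuclideanSpace ℂ (Fin n) | r < ‖z‖ ∧ ‖z‖ < R}) :
    ∃ F : EuclideanSpace ℂ (Fin n) → ℂ,
      DifferentiableOn ℂ F {z : EuclideanSpace ℂ (Fin n) | ‖z‖ < R} ∧
      ∀ z : EuclideanSpace ℂ (Fin n), r < ‖z‖ → ‖z‖ < R → F z = f z := by
  let i₀ : Fin n := ⟨0, by omega⟩
  let i₁ : Fin n := ⟨1, by omega⟩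
  have hne : i₀ ≠ i₁ := Fin.ne_of_val_ne zero_ne_one
  exact exists_differentiableOn_ball_eq_on_shell (e := EuclideanSpace.single i₀ 1)
    (e' := EuclideanSpace.single i₁ 1) (by simp) (by simp)
    (by simp [EuclideanSpace.inner_single_left, hne]) hr0
    (hr1.trans hR) hf
end

section
/- (Hartogs extension phenomenon) Let n ≥ 2, let D ⊆ ℂⁿ be open, and let K ⊆ D be a compact subset such that D ∖ K is connected. Then every function f holomorphic on D ∖ K extends to D: there exists F holomorphic on D with F = f on D ∖ K. -/
open Set Filter Topology Metric MeasureTheory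

/-- A holomorphic function on an open subset of a finite-dimensional complex space is `C¹`. -/
theorem contDiffOn_one_of_differentiableOn_complex {E : Type*} [NormedAddCommGroup E]
    [NormedSpace ℂ E] [FiniteDimensional ℂ E] {f : E → ℂ} {U : Set E}
    (hf : DifferentiableOn ℂ f U) (hU : IsOpen U) : ContDiffOn ℂ 1 f U := by
  have : ProperSpace E := FiniteDimensional.proper ℂ E
  rw [show (1 : WithTop ℕ∞) = 0 + 1 by simp, contDiffOn_succ_iff_fderiv_of_isOpen hU]
  refine ⟨hf, by simp, contDiffOn_zero.2 fun z hz => ContinuousAt.continuousWithinAt ?_⟩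
  obtain ⟨R, hR, hRU⟩ := Metric.isOpen_iff.1 hU z hz
  obtain ⟨r, hr, hrR⟩ : ∃ r : ℝ, 0 < r ∧ 2 * r < R := ⟨R / 3, by positivity, by linarith⟩
  have hsub : closedBall z (2 * r) ⊆ U := (closedBall_subset_ball hrR).trans hRU
  have huc := (isCompact_closedBall z (2 * r)).uniformContinuousOn_of_continuous
    (hf.continuousOn.mono hsub)
  rw [Metric.uniformContinuousOn_iff] at huc
  rw [Metric.continuousAt_iff]
  intro ε hε
  obtain ⟨δ, hδ, h⟩ := huc (ε / 2 * r) (by positivity)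
  refine ⟨min δ r, by positivity, fun w hw => ?_⟩
  have hwδ : dist w z < δ := hw.trans_le (min_le_left _ _)
  have hwr : dist w z < r := hw.trans_le (min_le_right _ _)
  rw [dist_eq_norm]
  refine (ContinuousLinearMap.opNorm_le_of_unit_norm (𝕜 := ℂ) (C := ε / 2) (by positivity)
    fun v hv => ?_).trans_lt (by linarith)
  have hmem (x : E) (hx : dist x z < r) (t : ℂ) (ht : t ∈ closedBall (0 : ℂ) r) :
      x + t • v ∈ closedBall z (2 * r) := by
    rw [mem_closedBall, dist_eq_norm] at *
    calc ‖x + t • v - z‖ = ‖(x - z) + t • v‖ := by congr 1; abel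
      _ ≤ ‖x - z‖ + ‖t • v‖ := norm_add_le _ _
      _ ≤ 2 * r := by
        rw [norm_smul, hv, mul_one]
        simp at ht
        linarith
  have hd (x : E) (hx : dist x z < r) (t : ℂ) (ht : t ∈ closedBall (0 : ℂ) r) :
      HasDerivAt (fun t : ℂ => f (x + t • v)) (fderiv ℂ f (x + t • v) v) t := by
    have h1 : HasDerivAt (fun t : ℂ => x + t • v) v t := by
      simpa using ((hasDerivAt_id t).smul_const v).const_add x
    exact ((hf.differentiableAt (hU.mem_nhds (hsub (hmem x hx t ht)))).hasFDerivAt).comp_hasDerivAt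
      t h1
  have hzz : dist z z < r := by simpa
  have h0 : (0 : ℂ) ∈ closedBall (0 : ℂ) r := by simp [hr.le]
  have hder := (hd w hwr 0 h0).sub (hd z hzz 0 h0)
  have key := Complex.norm_deriv_le_of_forall_mem_sphere_norm_le (c := 0) (R := r)
    (C := ε / 2 * r) (f := (fun t : ℂ => f (w + t • v)) - fun t : ℂ => f (z + t • v)) hr
    (DifferentiableOn.diffContOnCl (by
      rw [closure_ball _ hr.ne']
      exact fun t ht => ((hd w hwr t ht).sub
        (hd z hzz t ht)).differentiableAt.differentiableWithinAt))
    (fun t ht => by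
      have ht' := sphere_subset_closedBall ht
      have := h _ (hmem w hwr t ht') _ (hmem z hzz t ht') (by simpa using hwδ)
      rw [dist_eq_norm] at this
      exact this.le)
  rw [hder.deriv] at key
  simpa [hr.ne'] using key

/-- The identity theorem for holomorphic functions on a connected open set. -/
theorem eqOn_zero_of_differentiableOn_complex_of_eventuallyEq_zero {E : Type*}
    [NormedAddCommGroup E] [NormedSpace ℂ E] {g : E → ℂ} {U : Set E}
    (hg : DifferentiableOn ℂ g U) (hU : IsOpen U) (hconn : IsPreconnected U) {z₀ : E}
    (hz₀ : z₀ ∈ U) (h : g =ᶠ[𝓝 z₀] 0) : EqOn g 0 U := by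
  have hsub : U ⊆ {z | ∀ᶠ w in 𝓝 z, g w = 0} := by
    refine hconn.subset_of_closure_inter_subset isOpen_setOfPred_eventually_nhds ⟨z₀, hz₀, h⟩ ?_
    rintro z ⟨hz, hzU⟩
    obtain ⟨r, hr, hrU⟩ := Metric.isOpen_iff.1 hU z hzU
    obtain ⟨w, hw, hwr⟩ := Metric.mem_closure_iff.1 hz r hr
    rw [dist_comm] at hwr
    refine eventually_of_mem (ball_mem_nhds z hr) fun p hp => ?_
    let L : ℂ → E := fun t => w + t • (p - w)
    have hL : Continuous L := by fun_prop
    have hLd : Differentiable ℂ L := by fun_prop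
    have hconv : Convex ℝ (L ⁻¹' ball z r) := by
      intro s hs t ht a b ha hb hab
      have : L (a • s + b • t) = a • L s + b • L t := by
        simp only [L, smul_add, add_smul]
        have hw' : w = a • w + b • w := by rw [← add_smul, hab, one_smul]
        rw [smul_assoc, smul_assoc]
        nth_rewrite 1 [hw']
        abel
      rw [mem_preimage, this]
      exact convex_ball z r hs ht ha hb hab
    have hopen : IsOpen (L ⁻¹' ball z r) := isOpen_ball.preimage hL
    have han : AnalyticOnNhd ℂ (g ∘ L) (L ⁻¹' ball z r) :=
      ((hg.mono hrU).comp hLd.differentiableOn (mapsTo_preimage _ _)).analyticOnNhd hopen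
    have h0 : L 0 = w := by simp [L]
    have h1 : L 1 = p := by simp [L]
    have := han.eqOn_zero_of_preconnected_of_eventuallyEq_zero hconv.isPreconnected
      (z₀ := 0) (by simpa [h0] using hwr)
      ((hL.tendsto' 0 w h0).eventually hw)
    simpa [h1] using this (show (1 : ℂ) ∈ L ⁻¹' ball z r by simpa [h1] using hp)
  exact fun z hz => (hsub hz).self_of_nhds

/-- Twice the `(0,1)`-part of the real differential of `h` at `z`, evaluated at `v`. -/
noncomputable def dbar {E : Type*} [NormedAddCommGroup E] [NormedSpace ℂ E] (h : E → ℂ)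
    (v z : E) : ℂ :=
  fderiv ℝ h z v + Complex.I * fderiv ℝ h z (Complex.I • v)

/-- Lebesgue measure `dr dθ` on the polar strip `(0, ∞) × (-π, π]`. -/
noncomputable def polarStrip : Measure (ℝ × ℝ) :=
  (volume.restrict (Ioi 0)).prod (volume.restrict (Ioc (-Real.pi) Real.pi))

/-- The Cauchy transform of `h` along the complex lines directed by `e`, in polar coordinates. -/
noncomputable def cauchyTransform {E : Type*} [NormedAddCommGroup E] [NormedSpace ℂ E]
    (e : E) (h : E → ℂ) (z : E) : ℂ :=
  ∫ x : ℝ × ℝ, Complex.exp (-(x.2 * Complex.I)) *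
    h (z - (x.1 * Complex.exp (x.2 * Complex.I) : ℂ) • e) ∂polarStrip

section Dbar

variable {E : Type*} [NormedAddCommGroup E] [NormedSpace ℂ E]

theorem dbar_smul (h : E → ℂ) (c : ℂ) (v z : E) :
    dbar h (c • v) z = (starRingEnd ℂ) c * dbar h v z := by
  have key (w : E) : fderiv ℝ h z (c • w) =
      c.re * fderiv ℝ h z w + c.im * fderiv ℝ h z (Complex.I • w) := by
    have : c • w = c.re • w + c.im • Complex.I • w := by
      conv_lhs => rw [← Complex.re_add_im c]
      rw [add_smul, mul_smul, Complex.coe_smul, Complex.coe_smul]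
    rw [this, map_add, map_smul, map_smul]
    simp
  have hI : Complex.I • Complex.I • v = -v := by rw [smul_smul]; simp
  have hc : (starRingEnd ℂ) c = c.re - c.im * Complex.I := by
    apply Complex.ext <;> simp
  unfold dbar
  rw [smul_comm Complex.I c v, key, key, hI, map_neg, hc]
  linear_combination (c.im : ℂ) * fderiv ℝ h z (Complex.I • v) * Complex.I_sq

theorem dbar_eq_zero_of_differentiableAt {h : E → ℂ} {z : E} (hh : DifferentiableAt ℂ h z) (v : E) :
    dbar h v z = 0 := by
  unfold dbar
  rw [hh.fderiv_restrictScalars ℝ]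
  simp only [ContinuousLinearMap.coe_restrictScalars', map_smul, smul_eq_mul]
  linear_combination (fderiv ℂ h z v) * Complex.I_sq

theorem differentiableAt_of_dbar_eq_zero {h : E → ℂ} {z : E} (hh : DifferentiableAt ℝ h z)
    (h0 : ∀ v, dbar h v z = 0) : DifferentiableAt ℂ h z := by
  have hI (v : E) : fderiv ℝ h z (Complex.I • v) = Complex.I * fderiv ℝ h z v := by
    have := h0 v
    unfold dbar at this
    linear_combination (-Complex.I) * this + (fderiv ℝ h z (Complex.I • v)) * Complex.I_sq
  rw [differentiableAt_iff_restrictScalars ℝ hh]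
  refine ⟨{ toFun := fderiv ℝ h z, map_add' := map_add _, map_smul' := fun c v => ?_,
            cont := (fderiv ℝ h z).continuous }, rfl⟩
  have : c • v = c.re • v + c.im • Complex.I • v := by
    conv_lhs => rw [← Complex.re_add_im c]
    rw [add_smul, mul_smul, Complex.coe_smul, Complex.coe_smul]
  rw [this, map_add, map_smul, map_smul, hI]
  conv_rhs => rw [RingHom.id_apply, ← Complex.re_add_im c]
  simp only [Complex.real_smul, smul_eq_mul]
  ring

theorem dbar_congr {g h : E → ℂ} {z : E} (hgh : g =ᶠ[𝓝 z] h) (v : E) : dbar g v z = dbar h v z := by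
  unfold dbar
  rw [hgh.fderiv_eq]

theorem dbar_add {g h : E → ℂ} {z : E} (hg : DifferentiableAt ℝ g z) (hh : DifferentiableAt ℝ h z)
    (v : E) : dbar (g + h) v z = dbar g v z + dbar h v z := by
  unfold dbar
  rw [fderiv_add hg hh]
  simp only [add_apply]
  ring

theorem dbar_mul {g h : E → ℂ} {z : E} (hg : DifferentiableAt ℝ g z) (hh : DifferentiableAt ℝ h z)
    (v : E) : dbar (fun w => g w * h w) v z = g z * dbar h v z + h z * dbar g v z := by
  unfold dbar
  rw [fderiv_fun_mul hg hh]
  simp only [add_apply, smul_apply, smul_eq_mul]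
  ring

theorem contDiff_dbar {h : E → ℂ} (hh : ContDiff ℝ 2 h) (v : E) : ContDiff ℝ 1 (dbar h v) := by
  have : ContDiff ℝ 1 (fderiv ℝ h) := hh.fderiv_right (by norm_num)
  unfold dbar
  fun_prop

theorem dbar_comm {h : E → ℂ} (hh : ContDiff ℝ 2 h) (v w z : E) :
    dbar (dbar h v) w z = dbar (dbar h w) v z := by
  have hd : DifferentiableAt ℝ (fderiv ℝ h) z :=
    (hh.fderiv_right (m := 1) (by norm_num)).differentiable (by norm_num) z
  have hs : IsSymmSndFDerivAt ℝ h z := hh.contDiffAt.isSymmSndFDerivAt (by simp)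
  have key (v w : E) : fderiv ℝ (dbar h v) z w =
      fderiv ℝ (fderiv ℝ h) z w v + Complex.I * fderiv ℝ (fderiv ℝ h) z w (Complex.I • v) := by
    have : HasFDerivAt (dbar h v) ((fderiv ℝ (fderiv ℝ h) z).flip v +
        Complex.I • (fderiv ℝ (fderiv ℝ h) z).flip (Complex.I • v)) z := by
      have h1 (u : E) : HasFDerivAt (fun y => fderiv ℝ h y u)
          ((fderiv ℝ (fderiv ℝ h) z).flip u) z := by
        simpa using hd.hasFDerivAt.clm_apply (hasFDerivAt_const u z)
      exact (h1 v).add ((h1 (Complex.I • v)).const_mul Complex.I)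
    rw [this.fderiv]
    simp
  rw [dbar, dbar, key, key, key, key, hs.eq w v, hs.eq w (Complex.I • v),
    hs.eq (Complex.I • w) v, hs.eq (Complex.I • w) (Complex.I • v)]
  ring

end Dbar

section CauchyTransform

theorem integrable_polarStrip {G : Type*} [NormedAddCommGroup G] {ψ : ℝ × ℝ → G}
    (hψ : AEStronglyMeasurable ψ polarStrip) {C R : ℝ}
    (hC : ∀ x, ‖ψ x‖ ≤ (Iic R ×ˢ univ).indicator (fun _ => C) x) : Integrable ψ polarStrip := by
  refine Integrable.mono' (g := (Iic R ×ˢ univ).indicator fun _ => C) ?_ hψ (ae_of_all _ hC)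
  rw [integrable_indicator_iff (measurableSet_Iic.prod MeasurableSet.univ)]
  refine integrableOn_const ?_
  rw [polarStrip, Measure.prod_prod, Measure.restrict_apply measurableSet_Iic, inter_comm,
    Ioi_inter_Iic]
  exact ENNReal.mul_ne_top (by simp) (by simp)

variable {E : Type*} [NormedAddCommGroup E] [NormedSpace ℂ E]

theorem exists_radius_of_hasCompactSupport {G : Type*} [Zero G] {h : E → G}
    (hh : HasCompactSupport h) {e : E} (he : e ≠ 0) (z₀ : E) :
    ∃ R : ℝ, ∀ z ∈ ball z₀ 1, ∀ r θ : ℝ, R < |r| →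
      h (z - (r * Complex.exp (θ * Complex.I) : ℂ) • e) = 0 := by
  obtain ⟨M, hM⟩ := hh.isCompact.isBounded.exists_norm_le
  have he' : 0 < ‖e‖ := norm_pos_iff.2 he
  refine ⟨(M + ‖z₀‖ + 1) / ‖e‖, fun z hz r θ hr => ?_⟩
  by_contra hne
  have h1 := hM _ (subset_tsupport _ hne)
  have h2 : ‖(r * Complex.exp (θ * Complex.I) : ℂ) • e‖ = |r| * ‖e‖ := by
    rw [norm_smul, norm_mul, Complex.norm_exp_ofReal_mul_I]
    simp
  rw [div_lt_iff₀ he', ← h2] at hr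
  have h3 := norm_sub_norm_le ((r * Complex.exp (θ * Complex.I) : ℂ) • e) z
  rw [norm_sub_rev] at h3
  have h4 := norm_sub_norm_le z z₀
  rw [mem_ball, dist_eq_norm] at hz
  linarith

theorem exists_bound_of_hasCompactSupport {G : Type*} [NormedAddCommGroup G] [NormedSpace ℂ G]
    {h : E → G} (hc : Continuous h) (hh : HasCompactSupport h) {e : E} (he : e ≠ 0) (z₀ : E) :
    ∃ C R : ℝ, ∀ z ∈ ball z₀ 1, ∀ x : ℝ × ℝ, ‖Complex.exp (-(x.2 * Complex.I)) •
      h (z - (x.1 * Complex.exp (x.2 * Complex.I) : ℂ) • e)‖ ≤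
        (Iic R ×ˢ univ).indicator (fun _ => C) x := by
  obtain ⟨C, hC⟩ := hh.exists_bound_of_continuous hc
  obtain ⟨R, hR⟩ := exists_radius_of_hasCompactSupport hh he z₀
  refine ⟨C, R, fun z hz x => ?_⟩
  by_cases hx : x.1 ≤ R
  · rw [indicator_of_mem (by simpa using hx), norm_smul, Complex.norm_exp]
    simpa using hC _
  · rw [indicator_of_notMem (by simpa using hx),
      hR z hz _ _ ((not_le.1 hx).trans_le (le_abs_self _))]
    simp

theorem integrable_polarStrip_comp {G : Type*} [NormedAddCommGroup G] [NormedSpace ℂ G]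
    {h : E → G} (hc : Continuous h) (hh : HasCompactSupport h) {e : E} (he : e ≠ 0) (z : E) :
    Integrable (fun x : ℝ × ℝ => Complex.exp (-(x.2 * Complex.I)) •
      h (z - (x.1 * Complex.exp (x.2 * Complex.I) : ℂ) • e)) polarStrip := by
  obtain ⟨C, R, hCR⟩ := exists_bound_of_hasCompactSupport hc hh he z
  exact integrable_polarStrip (Continuous.aestronglyMeasurable (by fun_prop))
    (hCR z (mem_ball_self one_pos))

theorem hasFDerivAt_cauchyTransform {h : E → ℂ} (hh : ContDiff ℝ 1 h) (hs : HasCompactSupport h)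
    {e : E} (he : e ≠ 0) (z : E) :
    HasFDerivAt (cauchyTransform e h) (∫ x : ℝ × ℝ, Complex.exp (-(x.2 * Complex.I)) •
      fderiv ℝ h (z - (x.1 * Complex.exp (x.2 * Complex.I) : ℂ) • e) ∂polarStrip) z := by
  have hc := hh.continuous
  have hc' : Continuous (fderiv ℝ h) := hh.continuous_fderiv (by norm_num)
  obtain ⟨C, R, hCR⟩ := exists_bound_of_hasCompactSupport hc' (hs.fderiv ℝ) he z
  have hbound : Integrable ((Iic R ×ˢ univ).indicator fun _ : ℝ × ℝ => C) polarStrip := by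
    refine integrable_polarStrip (C := |C|) (R := R) (Measurable.aestronglyMeasurable
      (measurable_const.indicator (measurableSet_Iic.prod MeasurableSet.univ))) fun x => ?_
    rw [norm_indicator_eq_indicator_norm]
    rfl
  refine hasFDerivAt_integral_of_dominated_of_fderiv_le (s := ball z 1)
    (ball_mem_nhds z one_pos)
    (Eventually.of_forall fun w => Continuous.aestronglyMeasurable (by fun_prop))
    (integrable_polarStrip_comp hc hs he z) (Continuous.aestronglyMeasurable (by fun_prop))
    (ae_of_all _ fun x w hw => hCR w hw x) hbound (ae_of_all _ fun x w _ => ?_)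
  have h1 : HasFDerivAt (fun w : E => w - (x.1 * Complex.exp (x.2 * Complex.I) : ℂ) • e)
      (ContinuousLinearMap.id ℝ E) w := (hasFDerivAt_id w).sub_const _
  exact (((hh.differentiable (by norm_num) _).hasFDerivAt).comp w h1).const_mul _

theorem dbar_cauchyTransform {h : E → ℂ} (hh : ContDiff ℝ 1 h) (hs : HasCompactSupport h)
    {e : E} (he : e ≠ 0) (v z : E) :
    dbar (cauchyTransform e h) v z = cauchyTransform e (dbar h v) z := by
  have hi := integrable_polarStrip_comp (hh.continuous_fderiv (by norm_num)) (hs.fderiv ℝ) he z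
  rw [dbar, (hasFDerivAt_cauchyTransform hh hs he z).fderiv,
    ContinuousLinearMap.integral_apply hi, ContinuousLinearMap.integral_apply hi,
    ← integral_const_mul, ← integral_add (hi.apply_continuousLinearMap v)
      ((hi.apply_continuousLinearMap (Complex.I • v)).const_mul _), cauchyTransform]
  refine integral_congr_ae (ae_of_all _ fun x => ?_)
  simp only [dbar, smul_apply, smul_eq_mul]
  ring

/-- The Cauchy–Pompeiu formula for compactly supported functions. -/
theorem cauchyTransform_dbar {h : E → ℂ} (hh : ContDiff ℝ 1 h) (hs : HasCompactSupport h)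
    {e : E} (he : e ≠ 0) (z : E) :
    cauchyTransform e (dbar h e) z = 2 * Real.pi * h z := by
  have hc' : Continuous (fderiv ℝ h) := hh.continuous_fderiv (by norm_num)
  set c : ℝ → ℂ := fun θ => Complex.exp (θ * Complex.I) with hcdef
  set w : ℝ → ℝ → E := fun r θ => z - ((r : ℂ) * c θ) • e with hwdef
  have hc : Continuous c := by fun_prop
  have hw : Continuous fun x : ℝ × ℝ => w x.1 x.2 := by fun_prop
  have hconj (θ : ℝ) : (starRingEnd ℂ) (c θ) = Complex.exp (-(θ * Complex.I)) := by
    rw [hcdef, ← Complex.exp_conj]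
    simp
  have hsplit (x : ℝ × ℝ) : Complex.exp (-(x.2 * Complex.I)) * dbar h e (w x.1 x.2) =
      fderiv ℝ h (w x.1 x.2) (c x.2 • e) +
        Complex.I * fderiv ℝ h (w x.1 x.2) (Complex.I • c x.2 • e) := by
    rw [← hconj, ← dbar_smul, dbar]
  obtain ⟨R, hR⟩ := exists_radius_of_hasCompactSupport (hs.fderiv ℝ) he z
  have hR := hR z (mem_ball_self one_pos)
  obtain ⟨C, hC⟩ := (hs.fderiv ℝ).exists_bound_of_continuous hc'
  have hint (a : ℂ) (ha : ‖a‖ = 1) :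
      Integrable (fun x : ℝ × ℝ => fderiv ℝ h (w x.1 x.2) (a • c x.2 • e)) polarStrip := by
    refine integrable_polarStrip (C := C * ‖e‖) (R := R)
      (Continuous.aestronglyMeasurable (by fun_prop)) fun x => ?_
    by_cases hx : x.1 ≤ R
    · rw [indicator_of_mem (by simpa using hx)]
      refine (ContinuousLinearMap.le_of_opNorm_le _ (hC _) _).trans_eq ?_
      rw [norm_smul, norm_smul, ha, hcdef, Complex.norm_exp_ofReal_mul_I, one_mul, one_mul]
    · rw [indicator_of_notMem (by simpa using hx), hwdef, hcdef]
      simp only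
      rw [hR _ _ ((not_le.1 hx).trans_le (le_abs_self _))]
      simp
  have hi1 := hint 1 (by simp)
  simp only [one_smul] at hi1
  have hi2 := (hint Complex.I (by simp)).const_mul Complex.I
  have hd (y : E) : HasFDerivAt h (fderiv ℝ h y) y :=
    (hh.differentiable (by norm_num) y).hasFDerivAt
  have hrad (θ : ℝ) : ∫ r in Ioi (0 : ℝ), fderiv ℝ h (w r θ) (c θ • e) = h z := by
    have hder (r : ℝ) : HasDerivAt (fun r => h (w r θ)) (-fderiv ℝ h (w r θ) (c θ • e)) r := by
      have h1 : HasDerivAt (fun r : ℝ => w r θ) (-(c θ • e)) r := by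
        have := ((((hasDerivAt_id r).ofReal_comp).mul_const (c θ)).smul_const e).const_sub z
        simpa using this
      rw [← map_neg]
      exact (hd (w r θ)).comp_hasDerivAt r h1
    have hcs : HasCompactSupport fun r => h (w r θ) := by
      obtain ⟨R, hR⟩ := exists_radius_of_hasCompactSupport hs he z
      refine HasCompactSupport.of_support_subset_isCompact (isCompact_closedBall 0 R) fun r hr => ?_
      by_contra hr'
      exact hr (hR z (mem_ball_self one_pos) r θ (by simpa using hr'))
    have hcd : ContDiff ℝ 1 fun r => h (w r θ) := by
      rw [contDiff_one_iff_deriv, funext fun r => (hder r).deriv]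
      exact ⟨fun r => (hder r).differentiableAt, by fun_prop⟩
    have := hcs.integral_Ioi_deriv_eq hcd 0
    rw [funext fun r => (hder r).deriv, integral_neg] at this
    have hw0 : w 0 θ = z := by simp [hwdef]
    rw [hw0] at this
    exact neg_injective this
  have hang (r : ℝ) (hr : r ∈ Ioi (0 : ℝ)) :
      ∫ θ in Ioc (-Real.pi) Real.pi,
        Complex.I * fderiv ℝ h (w r θ) (Complex.I • c θ • e) = 0 := by
    rw [integral_const_mul, ← intervalIntegral.integral_of_le (by linarith [Real.pi_pos])]
    have hder (θ : ℝ) : HasDerivAt (fun θ => h (w r θ))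
        (-r * fderiv ℝ h (w r θ) (Complex.I • c θ • e)) θ := by
      have hcθ : HasDerivAt c (c θ * Complex.I) θ := by
        have := (((hasDerivAt_id θ).ofReal_comp).mul_const Complex.I).cexp
        simpa using this
      have h1 : HasDerivAt (w r) (-(((r : ℂ) * (c θ * Complex.I)) • e)) θ :=
        ((hcθ.const_mul (r : ℂ)).smul_const e).const_sub z
      have h2 : fderiv ℝ h (w r θ) (-(((r : ℂ) * (c θ * Complex.I)) • e)) =
          -r * fderiv ℝ h (w r θ) (Complex.I • c θ • e) := by
        rw [map_neg, mul_smul, mul_comm (c θ), mul_smul, Complex.coe_smul, map_smul]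
        simp
      rw [← h2]
      exact (hd (w r θ)).comp_hasDerivAt θ h1
    have := intervalIntegral.integral_eq_sub_of_hasDerivAt (a := -Real.pi) (b := Real.pi)
      (fun θ _ => hder θ) (Continuous.intervalIntegrable (by fun_prop) _ _)
    have hper : w r Real.pi = w r (-Real.pi) := by
      simp [hwdef, hcdef, Complex.exp_neg, Complex.exp_pi_mul_I]
    rw [hper, sub_self, intervalIntegral.integral_const_mul] at this
    have hr' : (-r : ℂ) ≠ 0 := by simpa using (ne_of_gt hr)
    rw [(mul_eq_zero.1 this).resolve_left hr', mul_zero]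
  have hmain : cauchyTransform e (dbar h e) z =
      ∫ x, (fderiv ℝ h (w x.1 x.2) (c x.2 • e) +
        Complex.I * fderiv ℝ h (w x.1 x.2) (Complex.I • c x.2 • e)) ∂polarStrip :=
    integral_congr_ae (ae_of_all _ hsplit)
  rw [hmain, integral_add hi1 hi2]
  unfold polarStrip at hi1 hi2 ⊢
  rw [integral_prod_symm _ hi1, integral_prod _ hi2]
  simp only [hrad]
  rw [setIntegral_congr_fun measurableSet_Ioi hang]
  have : (0 : ℝ) ≤ Real.pi + Real.pi := by linarith [Real.pi_pos]
  simp [Measure.real, this, two_mul]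

end CauchyTransform

open scoped Manifold in
/-- A `C²` complex-valued cutoff function equal to `1` near `K` and to `0` near the complement
of the closed set `K'`. -/
theorem exists_complex_cutoff {E : Type*} [NormedAddCommGroup E] [NormedSpace ℂ E]
    [FiniteDimensional ℂ E] {K K' : Set E} (hK : IsClosed K) (hK' : IsClosed K')
    (hKK' : K ⊆ interior K') :
    ∃ χ : E → ℂ, ContDiff ℝ 2 χ ∧ (∀ z ∈ K, χ =ᶠ[𝓝 z] fun _ => 1) ∧
      ∀ z ∉ K', χ =ᶠ[𝓝 z] fun _ => 0 := by
  have : FiniteDimensional ℝ E := FiniteDimensional.complexToReal E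
  obtain ⟨χ, h1, h0, -⟩ :=
    exists_contMDiffMap_one_nhds_of_subset_interior (n := 2) 𝓘(ℝ, E) hK hKK'
  refine ⟨fun z => (χ z : ℂ), Complex.ofRealCLM.contDiff.comp χ.contMDiff.contDiff,
    fun z hz => ?_, fun z hz => ?_⟩
  · filter_upwards [h1.filter_mono (nhds_le_nhdsSet hz)] with w hw
    simp [hw]
  · filter_upwards [hK'.isOpen_compl.mem_nhds hz] with w hw
    simp [h0 w hw]

/-- The Hartogs extension phenomenon in a finite-dimensional complex space that contains a nonzero
vector `e` killed by a nonzero linear functional, i.e. a space of dimension at least two. -/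
theorem exists_holomorphic_extension_of_isCompact {E : Type*} [NormedAddCommGroup E]
    [NormedSpace ℂ E] [FiniteDimensional ℂ E] {e q : E} (he : e ≠ 0) (ℓ : E →L[ℂ] ℂ)
    (hℓe : ℓ e = 0) (hℓq : ℓ q = 1) {D K : Set E} (hD : IsOpen D) (hK : IsCompact K)
    (hKD : K ⊆ D) (hconn : IsPreconnected (D \ K)) {f : E → ℂ}
    (hf : DifferentiableOn ℂ f (D \ K)) :
    ∃ F : E → ℂ, DifferentiableOn ℂ F D ∧ EqOn F f (D \ K) := by
  rcases K.eq_empty_or_nonempty with rfl | hKne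
  · exact ⟨f, by simpa using hf, fun _ _ => rfl⟩
  have : ProperSpace E := FiniteDimensional.proper ℂ E
  have hU : IsOpen (D \ K) := hD.sdiff hK.isClosed
  obtain ⟨K', hK', hKK', hK'D⟩ := exists_compact_between hK hD hKD
  obtain ⟨χ, hχ, hχ1, hχ0⟩ := exists_complex_cutoff hK.isClosed hK'.isClosed hKK'
  have hχd : Differentiable ℝ χ := hχ.differentiable (by norm_num)
  have hfC := contDiffOn_one_of_differentiableOn_complex hf hU
  have hfd {z : E} (hz : z ∈ D \ K) : DifferentiableAt ℂ f z :=
    hf.differentiableAt (hU.mem_nhds hz)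
  have hfdR {z : E} (hz : z ∈ D \ K) : DifferentiableAt ℝ f z := (hfd hz).restrictScalars ℝ
  set ω : E → E → ℂ := fun v z => f z * dbar χ v z with hω
  have dbar_const (a : ℂ) (v z : E) : dbar (fun _ => a) v z = 0 := by simp [dbar]
  have hωK (v : E) {z : E} (hz : z ∈ K) : ω v =ᶠ[𝓝 z] fun _ => 0 := by
    filter_upwards [(hχ1 z hz).eventuallyEq_nhds] with w hw
    rw [hω]
    simp only
    rw [dbar_congr hw, dbar_const, mul_zero]
  have hωK' (v : E) {z : E} (hz : z ∉ K') : ω v =ᶠ[𝓝 z] fun _ => 0 := by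
    filter_upwards [(hχ0 z hz).eventuallyEq_nhds] with w hw
    rw [hω]
    simp only
    rw [dbar_congr hw, dbar_const, mul_zero]
  have hcases (z : E) : z ∈ K ∨ z ∉ K' ∨ z ∈ D \ K := by
    by_cases h1 : z ∈ K
    · exact Or.inl h1
    by_cases h2 : z ∈ K'
    · exact Or.inr (Or.inr ⟨hK'D h2, h1⟩)
    · exact Or.inr (Or.inl h2)
  have hωC (v : E) : ContDiff ℝ 1 (ω v) := by
    rw [contDiff_iff_contDiffAt]
    intro z
    rcases hcases z with hz | hz | hz
    · exact contDiffAt_const.congr_of_eventuallyEq (hωK v hz)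
    · exact contDiffAt_const.congr_of_eventuallyEq (hωK' v hz)
    · exact ((hfC.contDiffAt (hU.mem_nhds hz)).restrict_scalars ℝ).mul
        (contDiff_dbar hχ v).contDiffAt
  have hωs (v : E) : HasCompactSupport (ω v) :=
    HasCompactSupport.intro hK' fun z hz => (hωK' v hz).self_of_nhds
  have hcomm (v : E) : dbar (ω e) v = dbar (ω v) e := by
    funext z
    rcases hcases z with hz | hz | hz
    · rw [dbar_congr (hωK e hz), dbar_congr (hωK v hz), dbar_const, dbar_const]
    · rw [dbar_congr (hωK' e hz), dbar_congr (hωK' v hz), dbar_const, dbar_const]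
    · have hd (v : E) := (contDiff_dbar hχ v).differentiable (by norm_num) z
      rw [hω, dbar_mul (hfdR hz) (hd e), dbar_mul (hfdR hz) (hd v),
        dbar_eq_zero_of_differentiableAt (hfd hz), dbar_eq_zero_of_differentiableAt (hfd hz),
        dbar_comm hχ e v]
      ring
  set u : E → ℂ := cauchyTransform e (ω e) with hu
  have hud (z : E) : DifferentiableAt ℝ u z :=
    (hasFDerivAt_cauchyTransform (hωC e) (hωs e) he z).differentiableAt
  have hdu (v z : E) : dbar u v z = 2 * Real.pi * ω v z := by
    rw [hu, dbar_cauchyTransform (hωC e) (hωs e) he, hcomm,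
      cauchyTransform_dbar (hωC v) (hωs v) he]
  set F : E → ℂ := fun z => (1 - χ z) * f z + (2 * Real.pi : ℂ)⁻¹ * u z with hF
  have hFD : DifferentiableOn ℂ F D := by
    intro z hz
    have hud' : DifferentiableAt ℝ (fun z => (2 * Real.pi : ℂ)⁻¹ * u z) z :=
      (hud z).const_mul _
    have hdu' (v : E) : dbar (fun z => (2 * Real.pi : ℂ)⁻¹ * u z) v z = ω v z := by
      rw [dbar_mul (differentiableAt_const _) (hud z), dbar_const, hdu]
      field_simp
      simp
    by_cases hzK : z ∈ K
    · have h0 : (fun z => (1 - χ z) * f z) =ᶠ[𝓝 z] fun _ => 0 := by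
        filter_upwards [hχ1 z hzK] with w hw
        simp [hw]
      have hd : DifferentiableAt ℝ (fun z => (1 - χ z) * f z) z :=
        (differentiableAt_const _).congr_of_eventuallyEq h0
      refine (differentiableAt_of_dbar_eq_zero (hd.add hud') fun v => ?_).differentiableWithinAt
      rw [dbar_add hd hud', dbar_congr h0, dbar_const, hdu', (hωK v hzK).self_of_nhds,
        add_zero]
    · have hzU : z ∈ D \ K := ⟨hz, hzK⟩
      have h1χ : DifferentiableAt ℝ (fun z => 1 - χ z) z := (hχd z).const_sub 1
      have hd : DifferentiableAt ℝ (fun z => (1 - χ z) * f z) z := h1χ.mul (hfdR hzU)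
      refine (differentiableAt_of_dbar_eq_zero (hd.add hud') fun v => ?_).differentiableWithinAt
      have h2 : dbar (fun z => 1 - χ z) v z = -dbar χ v z := by
        simp only [dbar, fderiv_const_sub, neg_apply]
        ring
      rw [dbar_add hd hud', dbar_mul h1χ (hfdR hzU), hdu', h2,
        dbar_eq_zero_of_differentiableAt (hfd hzU), hω]
      ring
  refine ⟨F, hFD, ?_⟩
  obtain ⟨p, hp, hmax⟩ := hK'.exists_isMaxOn (hKne.mono (hKK'.trans interior_subset))
    (f := fun z => (ℓ z).re) (by fun_prop)
  have hout {z : E} (hz : (ℓ p).re < (ℓ z).re) : z ∉ K' := fun h => (hmax h).not_gt hz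
  have hFf {z : E} (hz : (ℓ p).re < (ℓ z).re) : F z = f z := by
    have hu0 : u z = 0 := by
      rw [hu, cauchyTransform]
      refine integral_eq_zero_of_ae (ae_of_all _ fun x => ?_)
      have := hωK' e (hout (z := z - (x.1 * Complex.exp (x.2 * Complex.I) : ℂ) • e)
        (by simpa [hℓe] using hz))
      simp [this.self_of_nhds]
    simp [hF, hu0, (hχ0 z (hout hz)).self_of_nhds]
  obtain ⟨t, htD, ht⟩ : ∃ t : ℝ, p + t • q ∈ D ∧ 0 < t := by
    have hcont : Tendsto (fun t : ℝ => p + t • q) (𝓝[>] 0) (𝓝 p) := by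
      have : Continuous fun t : ℝ => p + t • q := by fun_prop
      exact (this.tendsto' 0 p (by simp)).mono_left nhdsWithin_le_nhds
    exact ((hcont.eventually (hD.mem_nhds (hK'D hp))).and self_mem_nhdsWithin).exists
  have htp : (ℓ p).re < (ℓ (p + t • q)).re := by
    rw [map_add, ← Complex.coe_smul, map_smul, hℓq]
    simpa using ht
  have hopen : IsOpen {z : E | (ℓ p).re < (ℓ z).re} := isOpen_lt (by fun_prop) (by fun_prop)
  have hzero := eqOn_zero_of_differentiableOn_complex_of_eventuallyEq_zero
    ((hFD.mono sdiff_subset).sub hf) hU hconn (z₀ := p + t • q)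
    ⟨htD, fun h => hout htp (interior_subset (hKK' h))⟩ (by
      filter_upwards [hopen.mem_nhds htp] with z hz
      simp [hFf hz])
  exact fun z hz => sub_eq_zero.1 (hzero hz)

/-- **Hartogs extension phenomenon.** Let `n ≥ 2`, let `D ⊆ ℂⁿ` be open and `K ⊆ D` compact
with `D \ K` connected.  Then every function holomorphic on `D \ K` extends holomorphically
to all of `D`. -/
theorem hartogs_extension_phenomenon (n : ℕ) (hn : 2 ≤ n)
    (D K : Set (EuclideanSpace ℂ (Fin n))) (hD : IsOpen D) (hK : IsCompact K)
    (hKD : K ⊆ D) (hconn : IsConnected (D \ K))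
    (f : EuclideanSpace ℂ (Fin n) → ℂ) (hf : DifferentiableOn ℂ f (D \ K)) :
    ∃ F : EuclideanSpace ℂ (Fin n) → ℂ,
      DifferentiableOn ℂ F D ∧ Set.EqOn F f (D \ K) := by
  let i : Fin n := ⟨0, by omega⟩
  let j : Fin n := ⟨1, by omega⟩
  have hij : j ≠ i := by simp [i, j]
  exact exists_holomorphic_extension_of_isCompact (e := EuclideanSpace.single i (1 : ℂ))
    (q := EuclideanSpace.single j (1 : ℂ)) (by simp) (EuclideanSpace.proj j) (by simp [hij])
    (by simp) hD hK hKD hconn.isPreconnected hf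
end
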